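/- (Maximum entropy sequential sampling criterion, Lemma 4.) Let P ∈ ℝ^{m₁×m₁} and Q ∈ ℝ^{m₂×m₂} be symmetric idempotent, σ² > 0, η² > 0, γ² = η²/σ². Let Ω be a sequence of N pairwise distinct indices, and for any (i,j) ∉ Ω define H((i,j)|Ω) := P_{i,i} Q_{j,j} − ν_{i,j}(Ω)ᵀ (R_N(Ω)+γ²I)^{-1} ν_{i,j}(Ω). Then for any two candidate indices (i,j) ∉ Ω and (i',j') ∉ Ω, the observational entropies H(Ω ∪ (i,j)) = det( σ² R_{N+1}(Ω∪(i,j)) + η² I ) satisfy: H(Ω ∪ (i,j)) ≥ H(Ω ∪ (i',j')) if and only if H((i,j)|Ω) ≥ H((i',j')|Ω). In particular, an index maximizing H(Ω ∪ (i,j)) over (i,j) ∉ Ω is exactly an index maximizing H((i,j)|Ω). -/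

import Mathlib

open Matrix

noncomputable section

/-- The design covariance matrix `R_N(Ω)` with entries `P_{i_n,i_{n'}} Q_{j_n,j_{n'}}`. -/
def designR {m₁ m₂ N : ℕ} (P : Matrix (Fin m₁) (Fin m₁) ℝ) (Q : Matrix (Fin m₂) (Fin m₂) ℝ)
    (Ω : Fin N → Fin m₁ × Fin m₂) : Matrix (Fin N) (Fin N) ℝ :=
  Matrix.of fun n n' => P (Ω n).1 (Ω n').1 * Q (Ω n).2 (Ω n').2

/-- The cross-coherence vector `ν_{k,l}(Ω)` with `n`-th entry `P_{k,i_n} Q_{l,j_n}`. -/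
def nuVec {m₁ m₂ N : ℕ} (P : Matrix (Fin m₁) (Fin m₁) ℝ) (Q : Matrix (Fin m₂) (Fin m₂) ℝ)
    (Ω : Fin N → Fin m₁ × Fin m₂) (k : Fin m₁) (l : Fin m₂) : Fin N → ℝ :=
  fun n => P k (Ω n).1 * Q l (Ω n).2

/-- Conditional variance formula `v_Ω(k,l)`. -/
def condVar {m₁ m₂ N : ℕ} (σ2 γ2 : ℝ) (P : Matrix (Fin m₁) (Fin m₁) ℝ)
    (Q : Matrix (Fin m₂) (Fin m₂) ℝ) (Ω : Fin N → Fin m₁ × Fin m₂)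
    (k : Fin m₁) (l : Fin m₂) : ℝ :=
  σ2 * (P k k * Q l l -
    nuVec P Q Ω k l ⬝ᵥ ((designR P Q Ω + γ2 • (1 : Matrix (Fin N) (Fin N) ℝ))⁻¹ *ᵥ nuVec P Q Ω k l))

/-- Conditional covariance formula `c_Ω((i,j),(k,l))`. -/
def condCov {m₁ m₂ N : ℕ} (σ2 γ2 : ℝ) (P : Matrix (Fin m₁) (Fin m₁) ℝ)
    (Q : Matrix (Fin m₂) (Fin m₂) ℝ) (Ω : Fin N → Fin m₁ × Fin m₂)
    (i k : Fin m₁) (j l : Fin m₂) : ℝ :=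
  σ2 * (P i k * Q j l -
    nuVec P Q Ω i j ⬝ᵥ ((designR P Q Ω + γ2 • (1 : Matrix (Fin N) (Fin N) ℝ))⁻¹ *ᵥ nuVec P Q Ω k l))

/-- Observational entropy `H(Ω) = det(σ² R_N(Ω) + η² I)`. -/
def obsEntropy {m₁ m₂ N : ℕ} (σ2 η2 : ℝ) (P : Matrix (Fin m₁) (Fin m₁) ℝ)
    (Q : Matrix (Fin m₂) (Fin m₂) ℝ) (Ω : Fin N → Fin m₁ × Fin m₂) : ℝ :=
  (σ2 • designR P Q Ω + η2 • (1 : Matrix (Fin N) (Fin N) ℝ)).det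

/-- Sequential criterion `H((i,j)|Ω)`. -/
def seqCrit {m₁ m₂ N : ℕ} (γ2 : ℝ) (P : Matrix (Fin m₁) (Fin m₁) ℝ)
    (Q : Matrix (Fin m₂) (Fin m₂) ℝ) (Ω : Fin N → Fin m₁ × Fin m₂)
    (i : Fin m₁) (j : Fin m₂) : ℝ :=
  P i i * Q j j -
    nuVec P Q Ω i j ⬝ᵥ ((designR P Q Ω + γ2 • (1 : Matrix (Fin N) (Fin N) ℝ))⁻¹ *ᵥ nuVec P Q Ω i j)


theorem posSemidef_of_symm_of_idem {n : Type*} [Fintype n] {A : Matrix n n ℝ}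
    (hsymm : Aᵀ = A) (hidem : A * A = A) : A.PosSemidef := by
  simpa [conjTranspose_eq_transpose_of_trivial, hsymm, hidem] using
    posSemidef_conjTranspose_mul_self A

theorem designR_posSemidef {m₁ m₂ N : ℕ} {P : Matrix (Fin m₁) (Fin m₁) ℝ}
    {Q : Matrix (Fin m₂) (Fin m₂) ℝ} (hP : P.PosSemidef) (hQ : Q.PosSemidef)
    (Ω : Fin N → Fin m₁ × Fin m₂) : (designR P Q Ω).PosSemidef :=
  (hP.kronecker hQ).submatrix Ω

theorem designR_add_smul_one_posDef {m₁ m₂ N : ℕ} {P : Matrix (Fin m₁) (Fin m₁) ℝ}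
    {Q : Matrix (Fin m₂) (Fin m₂) ℝ} (hP : P.PosSemidef) (hQ : Q.PosSemidef)
    (Ω : Fin N → Fin m₁ × Fin m₂) {γ2 : ℝ} (hγ2 : 0 < γ2) :
    (designR P Q Ω + γ2 • (1 : Matrix (Fin N) (Fin N) ℝ)).PosDef :=
  PosDef.posSemidef_add (designR_posSemidef hP hQ Ω) (PosDef.one.smul hγ2)

/-- Appending an index borders `R_N(Ω) + γ² I` by the cross-coherence vector. -/
theorem designR_snoc_submatrix {m₁ m₂ N : ℕ} {P : Matrix (Fin m₁) (Fin m₁) ℝ}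
    {Q : Matrix (Fin m₂) (Fin m₂) ℝ} (hP : Pᵀ = P) (hQ : Qᵀ = Q)
    (Ω : Fin N → Fin m₁ × Fin m₂) (γ2 : ℝ) (i : Fin m₁) (j : Fin m₂) :
    (designR P Q (Fin.snoc Ω (i, j) : Fin (N + 1) → Fin m₁ × Fin m₂) +
        γ2 • (1 : Matrix (Fin (N + 1)) (Fin (N + 1)) ℝ)).submatrix
          finSumFinEquiv finSumFinEquiv =
      fromBlocks (designR P Q Ω + γ2 • (1 : Matrix (Fin N) (Fin N) ℝ))
        (replicateCol (Fin 1) (nuVec P Q Ω i j)) (replicateRow (Fin 1) (nuVec P Q Ω i j))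
        (of fun _ _ => P i i * Q j j + γ2) := by
  have hcast (a : Fin N) : (Fin.snoc Ω (i, j) : Fin (N + 1) → Fin m₁ × Fin m₂)
      (Fin.castAdd 1 a) = Ω a := Fin.snoc_castSucc (α := fun _ => Fin m₁ × Fin m₂) _ _ a
  have hlast : (Fin.snoc Ω (i, j) : Fin (N + 1) → Fin m₁ × Fin m₂)
      (Fin.natAdd N 0) = (i, j) := Fin.snoc_last (α := fun _ => Fin m₁ × Fin m₂) _ _
  have hPs (a b) : P a b = P b a := congrFun₂ hP b a
  have hQs (a b) : Q a b = Q b a := congrFun₂ hQ b a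
  ext (a | a) (b | b)
  · simp [designR, hcast, one_apply, Fin.ext_iff]
  · obtain rfl := Subsingleton.elim b 0
    have : Fin.castAdd 1 a ≠ Fin.natAdd N 0 := by simp [Fin.ext_iff, a.isLt.ne]
    simp [designR, nuVec, hcast, hlast, one_apply, this, hPs _ i, hQs _ j]
  · obtain rfl := Subsingleton.elim a 0
    have : Fin.natAdd N 0 ≠ Fin.castAdd 1 b := by simp [Fin.ext_iff, b.isLt.ne']
    simp [designR, nuVec, hcast, hlast, one_apply, this]
  · obtain rfl := Subsingleton.elim a 0
    obtain rfl := Subsingleton.elim b 0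
    simp [designR, hlast]

/-- One-step-ahead entropy is an increasing affine function of the sequential criterion. -/
theorem obsEntropy_snoc {m₁ m₂ N : ℕ} {P : Matrix (Fin m₁) (Fin m₁) ℝ}
    {Q : Matrix (Fin m₂) (Fin m₂) ℝ} (hP : Pᵀ = P) (hQ : Qᵀ = Q)
    {σ2 η2 γ2 : ℝ} (hη2 : η2 = σ2 * γ2) (Ω : Fin N → Fin m₁ × Fin m₂)
    (hdet : (designR P Q Ω + γ2 • (1 : Matrix (Fin N) (Fin N) ℝ)).det ≠ 0)
    (i : Fin m₁) (j : Fin m₂) :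
    obsEntropy σ2 η2 P Q (Fin.snoc Ω (i, j) : Fin (N + 1) → Fin m₁ × Fin m₂) =
      σ2 ^ (N + 1) * (designR P Q Ω + γ2 • (1 : Matrix (Fin N) (Fin N) ℝ)).det *
        (seqCrit γ2 P Q Ω i j + γ2) := by
  have := invertibleOfIsUnitDet _ hdet.isUnit
  rw [obsEntropy, hη2, mul_smul, ← smul_add, det_smul, Fintype.card_fin,
    ← det_submatrix_equiv_self finSumFinEquiv, designR_snoc_submatrix hP hQ,
    det_fromBlocks₁₁, invOf_eq_nonsing_inv, det_fin_one, mul_assoc]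
  congr 2
  rw [Matrix.mul_assoc, ← replicateCol_mulVec, Matrix.sub_apply, replicateRow_mul_replicateCol_apply,
    of_apply, seqCrit]
  ring

/-- **Maximum entropy sequential sampling criterion, Lemma 4.**
For candidate indices `(i,j), (i',j') ∉ Ω`, one has
`H(Ω ∪ (i,j)) ≥ H(Ω ∪ (i',j'))` iff `H((i,j)|Ω) ≥ H((i',j')|Ω)`; in particular an index
maximizes the one-step-ahead observational entropy iff it maximizes the residual
coherence criterion. -/
theorem maxEntropy_seq_criterion {m₁ m₂ N : ℕ}
    (P : Matrix (Fin m₁) (Fin m₁) ℝ) (Q : Matrix (Fin m₂) (Fin m₂) ℝ)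
    (hPsymm : Pᵀ = P) (hPidem : P * P = P)
    (hQsymm : Qᵀ = Q) (hQidem : Q * Q = Q)
    (σ2 η2 γ2 : ℝ) (hσ2 : 0 < σ2) (hη2 : 0 < η2) (hγ2 : γ2 = η2 / σ2)
    (Ω : Fin N → Fin m₁ × Fin m₂) (hΩ : Function.Injective Ω) :
    (∀ (i i' : Fin m₁) (j j' : Fin m₂),
      (∀ n, Ω n ≠ (i, j)) → (∀ n, Ω n ≠ (i', j')) →
      (obsEntropy σ2 η2 P Q (Fin.snoc Ω (i, j)) ≥
          obsEntropy σ2 η2 P Q (Fin.snoc Ω (i', j')) ↔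
        seqCrit γ2 P Q Ω i j ≥ seqCrit γ2 P Q Ω i' j')) ∧
    (∀ (i : Fin m₁) (j : Fin m₂), (∀ n, Ω n ≠ (i, j)) →
      ((∀ (i' : Fin m₁) (j' : Fin m₂), (∀ n, Ω n ≠ (i', j')) →
          obsEntropy σ2 η2 P Q (Fin.snoc Ω (i', j')) ≤
            obsEntropy σ2 η2 P Q (Fin.snoc Ω (i, j))) ↔
        (∀ (i' : Fin m₁) (j' : Fin m₂), (∀ n, Ω n ≠ (i', j')) →
          seqCrit γ2 P Q Ω i' j' ≤ seqCrit γ2 P Q Ω i j))) := by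
  have hγ : 0 < γ2 := hγ2 ▸ div_pos hη2 hσ2
  have hdet := (designR_add_smul_one_posDef (posSemidef_of_symm_of_idem hPsymm hPidem)
    (posSemidef_of_symm_of_idem hQsymm hQidem) Ω hγ).det_pos
  have hη : η2 = σ2 * γ2 := by rw [hγ2, mul_div_cancel₀ _ hσ2.ne']
  have key (i i' : Fin m₁) (j j' : Fin m₂) :
      obsEntropy σ2 η2 P Q (Fin.snoc Ω (i', j') : Fin (N + 1) → Fin m₁ × Fin m₂) ≤
          obsEntropy σ2 η2 P Q (Fin.snoc Ω (i, j) : Fin (N + 1) → Fin m₁ × Fin m₂) ↔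
        seqCrit γ2 P Q Ω i' j' ≤ seqCrit γ2 P Q Ω i j := by
    rw [obsEntropy_snoc hPsymm hQsymm hη Ω hdet.ne', obsEntropy_snoc hPsymm hQsymm hη Ω hdet.ne',
      mul_le_mul_iff_right₀ (mul_pos (pow_pos hσ2 _) hdet), add_le_add_iff_right]
  exact ⟨fun i i' j j' _ _ => key i i' j j',
    fun i j _ => forall₃_congr fun i' j' _ => key i i' j j'⟩

end
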